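/- Let α, β be real numbers with β > 0 and |α| < β/2. Then the function f : ℝ → ℝ defined by f(x) = βx·cosh(αx)/sinh(βx) for x ≠ 0 and f(0) = 1 is positive definite; that is, for every n and all real numbers x₁, …, xₙ, the n×n matrix with (i,j) entry f(xᵢ − xⱼ) is positive semidefinite. (Lemma 2.1(iii)) -/

import Mathlib

open MeasureTheory Set Filter Topology

namespace Matrix

theorem PosSemidef.mul_entries {ι : Type*} {M N : ι → ι → ℝ} (hM : (of M).PosSemidef)
    (hN : (of N).PosSemidef) : (of fun i j => M i j * N i j).PosSemidef :=
  hM.hadamard hN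

variable {ι : Type*} [Fintype ι]

theorem PosSemidef.of_tendsto {κ : Type*} {l : Filter κ} [l.NeBot] {M : κ → Matrix ι ι ℝ}
    {A : Matrix ι ι ℝ} (hM : ∀ᶠ k in l, (M k).PosSemidef) (h : Tendsto M l (𝓝 A)) :
    A.PosSemidef := by
  refine .of_dotProduct_mulVec_nonneg ?_ fun v => ?_
  · have hc : Tendsto (fun k => (M k)ᴴ) l (𝓝 Aᴴ) :=
      (continuous_id.matrix_conjTranspose.tendsto A).comp h
    exact tendsto_nhds_unique (hc.congr' (hM.mono fun k hk => hk.isHermitian)) h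
  · have hc : Continuous fun B : Matrix ι ι ℝ => star v ⬝ᵥ (B *ᵥ v) := by fun_prop
    exact ge_of_tendsto ((hc.tendsto A).comp h) (hM.mono fun k hk => hk.dotProduct_mulVec_nonneg v)

theorem PosSemidef.integral {X : Type*} [MeasurableSpace X] {μ : Measure X}
    {M : X → Matrix ι ι ℝ} (hM : ∀ᵐ t ∂μ, (M t).PosSemidef)
    (hint : ∀ i j, Integrable (fun t => M t i j) μ) :
    (of fun i j => ∫ t, M t i j ∂μ).PosSemidef := by
  refine .of_dotProduct_mulVec_nonneg ?_ fun v => ?_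
  · ext i j
    simp only [conjTranspose_apply, of_apply, star_trivial]
    exact integral_congr_ae (hM.mono fun t ht => by simpa using ht.isHermitian.apply i j)
  · have key : star v ⬝ᵥ ((of fun i j => ∫ t, M t i j ∂μ) *ᵥ v)
        = ∫ t, star v ⬝ᵥ (M t *ᵥ v) ∂μ := by
      simp only [dotProduct, mulVec, of_apply]
      rw [integral_finsetSum _ fun i _ =>
        (integrable_finsetSum _ fun j _ => (hint i j).mul_const _).const_mul _]
      refine Finset.sum_congr rfl fun i _ => ?_
      rw [integral_const_mul, integral_finsetSum _ fun j _ => (hint i j).mul_const _]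
      simp only [integral_mul_const]
    rw [key]
    exact integral_nonneg_of_ae (hM.mono fun t ht => ht.dotProduct_mulVec_nonneg v)

theorem posSemidef_of_mul (d : ι → ℝ) : (of fun i j => d i * d j).PosSemidef := by
  simpa [vecMulVec] using posSemidef_vecMulVec_self_star d

theorem posSemidef_const {c : ℝ} (hc : 0 ≤ c) : (of fun _ _ : ι => c).PosSemidef := by
  simpa [Real.mul_self_sqrt hc] using posSemidef_of_mul fun _ : ι => √c

/-- The symmetric Cauchy matrix with positive nodes is positive semidefinite. -/
theorem posSemidef_cauchy {u : ι → ℝ} (hu : ∀ i, 0 < u i) :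
    (of fun i j => (u i + u j)⁻¹).PosSemidef := by
  have h := PosSemidef.integral (μ := volume.restrict (Ioi (0 : ℝ)))
    (M := fun t => of fun i j => Real.exp (-(u i + u j) * t))
    (.of_forall fun t => by
      convert posSemidef_of_mul fun i => Real.exp (-u i * t) using 4
      rw [← Real.exp_add]; ring_nf)
    fun i j => integrableOn_exp_mul_Ioi (by linarith [hu i, hu j]) 0
  convert h using 4 with i j
  simp only [of_apply]
  rw [integral_exp_mul_Ioi (by linarith [hu i, hu j]), mul_zero, Real.exp_zero, neg_div_neg_eq,
    one_div]

theorem posSemidef_rpow_add_rpow_div {u : ι → ℝ} (hu : ∀ i, 0 < u i) {s : ℝ} (hs0 : 0 ≤ s)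
    (hs1 : s < 1) : (of fun i j => (u i ^ s + u j ^ s) / (u i + u j)).PosSemidef := by
  rcases hs0.eq_or_lt with rfl | hs0
  · convert (posSemidef_const zero_le_two).mul_entries (posSemidef_cauchy hu) using 4
    simp only [Real.rpow_zero]
    ring
  have hs : s ∈ Ioo (0 : ℝ) 1 := ⟨hs0, hs1⟩
  have hint (i : ι) := Real.integrableOn_rpowIntegrand₀₁_Ioi hs (hu i).le
  set c : ℝ := (∫ t in Ioi 0, Real.rpowIntegrand₀₁ s t 1)⁻¹ with hc
  have hc0 : 0 ≤ c := inv_nonneg.2 <| setIntegral_nonneg measurableSet_Ioi fun t ht =>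
    Real.rpowIntegrand₀₁_nonneg hs0 (le_of_lt ht) zero_le_one
  have h := PosSemidef.integral (μ := volume.restrict (Ioi (0 : ℝ)))
    (M := fun t => of fun i j =>
      (Real.rpowIntegrand₀₁ s t (u i) + Real.rpowIntegrand₀₁ s t (u j)) / (u i + u j))
    ((ae_restrict_iff' measurableSet_Ioi).2 <| .of_forall fun t (ht : 0 < t) => by
      have hsum : (of fun i j => 2 * (u i * u j) * (u i + u j)⁻¹ + t).PosSemidef :=
        (((posSemidef_const zero_le_two).mul_entries (posSemidef_of_mul u)).mul_entries
          (posSemidef_cauchy hu)).add (posSemidef_const ht.le)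
      convert ((posSemidef_const (Real.rpow_nonneg ht.le (s - 1))).mul_entries
        (posSemidef_of_mul fun i => (t + u i)⁻¹)).mul_entries hsum using 4 with i j
      rw [Real.rpowIntegrand₀₁_eq_pow_div hs ht.le (hu i).le,
        Real.rpowIntegrand₀₁_eq_pow_div hs ht.le (hu j).le]
      have := hu i
      have := hu j
      field_simp
      ring)
    fun i j => ((hint i).add (hint j)).div_const _
  convert (posSemidef_const hc0).mul_entries h using 4 with i j
  simp only [of_apply]
  rw [Real.rpow_eq_const_mul_integral hs (hu i).le, Real.rpow_eq_const_mul_integral hs (hu j).le,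
    integral_div, integral_add (hint i) (hint j)]
  ring

/-- The function `cosh (a x) / cosh (b x)` is positive definite for `|a| < b`. -/
theorem posSemidef_cosh_div_cosh {a b : ℝ} (hab : |a| < b) (x : ι → ℝ) :
    (of fun i j => Real.cosh (a * (x i - x j)) / Real.cosh (b * (x i - x j))).PosSemidef := by
  wlog ha : 0 ≤ a generalizing a
  · simpa using this (a := -a) (by simpa using hab) (by linarith)
  rw [abs_of_nonneg ha] at hab
  have hb : 0 < b := ha.trans_lt hab
  have h := (posSemidef_rpow_add_rpow_div (u := fun i => Real.exp (2 * b * x i))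
    (fun i => Real.exp_pos _) (div_nonneg ha hb.le) ((div_lt_one hb).2 hab)).mul_entries
    (posSemidef_of_mul fun i => Real.exp ((b - a) * x i))
  convert h using 4 with i j
  have hpow (y : ℝ) : Real.exp (2 * b * y) ^ (a / b) = Real.exp (2 * a * y) := by
    rw [← Real.exp_mul]
    congr 1
    field_simp
  have hcosh (c y z : ℝ) : Real.exp (2 * c * y) + Real.exp (2 * c * z)
      = 2 * Real.exp (c * (y + z)) * Real.cosh (c * (y - z)) := by
    have hy : Real.exp (2 * c * y) = Real.exp (c * (y + z)) * Real.exp (c * (y - z)) := by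
      rw [← Real.exp_add]
      ring_nf
    have hz : Real.exp (2 * c * z) = Real.exp (c * (y + z)) * Real.exp (-(c * (y - z))) := by
      rw [← Real.exp_add]
      ring_nf
    rw [hy, hz, Real.cosh_eq]
    ring
  have hexp : Real.exp (b * (x i + x j))
      = Real.exp (a * (x i + x j)) * (Real.exp ((b - a) * x i) * Real.exp ((b - a) * x j)) := by
    rw [← Real.exp_add, ← Real.exp_add]
    ring_nf
  rw [hpow, hpow, hcosh, hcosh, hexp]
  have := Real.cosh_pos (b * (x i - x j))
  field_simp

theorem posSemidef_prod_inv_cosh (x : ι → ℝ) (m : ℕ) :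
    (of fun i j => ∏ k ∈ Finset.range m, (Real.cosh ((x i - x j) / 2 ^ (k + 1)))⁻¹).PosSemidef := by
  induction m with
  | zero => simpa using posSemidef_const (ι := ι) zero_le_one
  | succ m ih =>
    simp only [Finset.prod_range_succ]
    refine ih.mul_entries ?_
    have h := posSemidef_cosh_div_cosh (a := 0) (b := (2 ^ (m + 1))⁻¹) (by simp) x
    simpa [div_eq_inv_mul] using h

end Matrix

namespace Real

theorem sinh_eq_pow_mul_prod_cosh (y : ℝ) (m : ℕ) :
    sinh y = 2 ^ m * sinh (y / 2 ^ m) * ∏ k ∈ Finset.range m, cosh (y / 2 ^ (k + 1)) := by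
  induction m with
  | zero => simp
  | succ m ih =>
    have h : y / 2 ^ m = 2 * (y / 2 ^ (m + 1)) := by
      field_simp
      ring
    rw [ih, Finset.prod_range_succ, h, sinh_two_mul]
    ring

theorem tendsto_pow_mul_sinh_div_pow (y : ℝ) :
    Tendsto (fun m : ℕ => 2 ^ m * sinh (y / 2 ^ m)) atTop (𝓝 y) := by
  rcases eq_or_ne y 0 with rfl | hy
  · simp
  have hs : Tendsto (fun t : ℝ => t⁻¹ * sinh t) (𝓝[≠] 0) (𝓝 1) := by
    simpa using (hasDerivAt_sinh 0).tendsto_slope_zero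
  have h0 : Tendsto (fun m : ℕ => y / 2 ^ m) atTop (𝓝[≠] 0) := by
    refine tendsto_nhdsWithin_iff.2 ⟨?_, .of_forall fun m => by simp [hy]⟩
    exact tendsto_const_nhds.div_atTop (tendsto_pow_atTop_atTop_of_one_lt one_lt_two)
  have h := (hs.comp h0).const_mul y
  rw [mul_one] at h
  refine h.congr fun m => ?_
  simp only [Function.comp]
  field_simp

theorem tendsto_prod_inv_cosh (y : ℝ) :
    Tendsto (fun m : ℕ => ∏ k ∈ Finset.range m, (cosh (y / 2 ^ (k + 1)))⁻¹) atTop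
      (𝓝 (if y = 0 then 1 else y / sinh y)) := by
  split_ifs with hy
  · simp [hy]
  refine ((tendsto_pow_mul_sinh_div_pow y).div_const (sinh y)).congr fun m => ?_
  have hs : sinh y ≠ 0 := sinh_ne_zero.2 hy
  have hp : ∏ k ∈ Finset.range m, cosh (y / 2 ^ (k + 1)) ≠ 0 :=
    Finset.prod_ne_zero_iff.2 fun k _ => (cosh_pos _).ne'
  rw [Finset.prod_inv_distrib, div_eq_iff hs, sinh_eq_pow_mul_prod_cosh y m]
  field_simp

end Real

/-- The function `x / sinh x` is positive definite. -/
theorem Matrix.posSemidef_div_sinh {ι : Type*} [Fintype ι] (x : ι → ℝ) :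
    (Matrix.of fun i j =>
      if x i - x j = 0 then 1 else (x i - x j) / Real.sinh (x i - x j)).PosSemidef :=
  .of_tendsto (.of_forall (posSemidef_prod_inv_cosh x)) <|
    tendsto_pi_nhds.2 fun i => tendsto_pi_nhds.2 fun j => Real.tendsto_prod_inv_cosh (x i - x j)


/-- Lemma 2.1(iii): `x ↦ βx·cosh(αx)/sinh(βx)` (with value `1` at `x = 0`) is positive
definite when `β > 0` and `|α| < β/2`. -/
theorem x_cosh_div_sinh_posDef (α β : ℝ) (hβ : 0 < β) (hαβ : |α| < β / 2)
    (n : ℕ) (x : Fin n → ℝ) :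
    (Matrix.of fun i j : Fin n =>
      if x i - x j = 0 then 1
      else β * (x i - x j) * Real.cosh (α * (x i - x j)) / Real.sinh (β * (x i - x j))).PosSemidef := by
  have h := (Matrix.posSemidef_div_sinh fun i => β / 2 * x i).mul_entries
    (Matrix.posSemidef_cosh_div_cosh hαβ x)
  convert h using 4 with i j
  simp only [← mul_sub, mul_eq_zero, (half_pos hβ).ne', false_or]
  split_ifs with hx
  · simp [hx]
  have hs : Real.sinh (β / 2 * (x i - x j)) ≠ 0 :=
    Real.sinh_ne_zero.2 (mul_ne_zero (half_pos hβ).ne' hx)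
  have hc := Real.cosh_pos (β / 2 * (x i - x j))
  rw [show β * (x i - x j) = 2 * (β / 2 * (x i - x j)) by ring, Real.sinh_two_mul]
  field_simp
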